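/- Let n ≥ 1 and 0 ≤ k ≤ n be integers. The number of signed permutations σ of {±1, …, ±n} (bijections with σ(-x) = -σ(x) for all x) having exactly k descents equals Σ_{r=0}^{k} (-1)^r · C(n+1, r) · (2k-2r+1)^n, where descents are defined with respect to the linear order 1 < 2 < ⋯ < n < -n < ⋯ < -2 < -1: σ has a descent at position i for 1 ≤ i ≤ n-1 if σ(i) > σ(i+1) in this order, and a descent at position n if σ(n) < 0 as an integer. -/

import Mathlib

/-- The rank of `x` in the linear order `1 < 2 < ⋯ < n < -n < ⋯ < -2 < -1`
on `{±1, …, ±n}`: positive `x` has rank `x`, and negative `x` has rank `2n+1+x`. -/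
def signedRank (n : ℕ) (x : ℤ) : ℤ :=
  if 0 < x then x else 2 * (n : ℤ) + 1 + x

/-- The number of ascents of the word `l` followed by `0`. -/
def ascents : List ℤ → ℕ
  | [] => 0
  | a :: l => (if a < l.headD 0 then 1 else 0) + ascents l

/-- All words obtained from `l` by inserting `m` or `-m` at a position other than the first. -/
def tailInsertions (m : ℤ) : List ℤ → List (List ℤ)
  | [] => []
  | a :: l => (a :: m :: l) :: (a :: -m :: l) :: (tailInsertions m l).map (List.cons a)

/-- All words obtained from `l` by inserting `m` or `-m`. -/
def signedInsertions (m : ℤ) (l : List ℤ) : List (List ℤ) :=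
  (m :: l) :: (-m :: l) :: tailInsertions m l

/-- The words of all signed permutations on `n` symbols. -/
def signedWords : ℕ → List (List ℤ)
  | 0 => [[]]
  | n + 1 => (signedWords n).flatMap (signedInsertions ((n : ℤ) + 1))

theorem headD_of_mem_tailInsertions {m : ℤ} {l w : List ℤ} (h : w ∈ tailInsertions m l) (d : ℤ) :
    w.headD d = l.headD d := by
  cases l with
  | nil => simp [tailInsertions] at h
  | cons a l =>
    simp only [tailInsertions, List.mem_cons, List.mem_map] at h
    rcases h with rfl | rfl | ⟨v, -, rfl⟩ <;> rfl

theorem abs_headD_lt {m : ℤ} (hm : 0 < m) {l : List ℤ} (h : ∀ x ∈ l, |x| < m) :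
    |l.headD 0| < m := by
  cases l with
  | nil => simpa using hm
  | cons a l => simpa using h a (by simp)

theorem sum_tailInsertions (f : ℕ → ℤ) {m : ℤ} (hm : 0 < m) (l : List ℤ)
    (h : ∀ x ∈ l, |x| < m) :
    ((tailInsertions m l).map (fun w => f (ascents w))).sum =
      2 * ascents l * f (ascents l) + 2 * ((l.length : ℤ) - ascents l) * f (ascents l + 1) := by
  induction l generalizing f with
  | nil => simp [tailInsertions, ascents]
  | cons a l ih =>
    have hl : ∀ x ∈ l, |x| < m := fun x hx => h x (List.mem_cons_of_mem _ hx)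
    have ha := abs_lt.1 (h a (by simp))
    have hd := abs_lt.1 (abs_headD_lt hm hl)
    have hcons : ((tailInsertions m l).map (fun w => f (ascents (a :: w)))).sum =
        ((tailInsertions m l).map
          (fun w => f ((if a < l.headD 0 then 1 else 0) + ascents w))).sum := by
      congr 1
      refine List.map_congr_left fun w hw => ?_
      rw [ascents, headD_of_mem_tailInsertions hw]
    have hpos : ascents (a :: m :: l) = 1 + ascents l := by
      rw [ascents, if_pos (show a < (m :: l).headD 0 from ha.2), ascents,
        if_neg (not_lt.2 hd.2.le), zero_add]
    have hneg : ascents (a :: -m :: l) = 1 + ascents l := by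
      rw [ascents, if_neg (show ¬ a < (-m :: l).headD 0 from not_lt.2 ha.1.le), ascents,
        if_pos hd.1, zero_add]
    simp only [tailInsertions, List.map_cons, List.sum_cons, List.map_map, Function.comp_def,
      hcons, hpos, hneg]
    rw [ih (fun j => f ((if a < l.headD 0 then 1 else 0) + j)) hl]
    simp only [ascents, List.length_cons]
    split_ifs
    · push_cast
      rw [show 1 + (ascents l + 1) = 1 + ascents l + 1 by ring]
      ring
    · push_cast
      simp only [zero_add]
      rw [add_comm 1 (ascents l)]
      ring

theorem sum_signedInsertions (f : ℕ → ℤ) {m : ℤ} (hm : 0 < m) (l : List ℤ)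
    (h : ∀ x ∈ l, |x| < m) :
    ((signedInsertions m l).map (fun w => f (ascents w))).sum =
      (2 * ascents l + 1) * f (ascents l) +
        (2 * ((l.length : ℤ) - ascents l) + 1) * f (ascents l + 1) := by
  have hd := abs_lt.1 (abs_headD_lt hm h)
  have hpos : ascents (m :: l) = ascents l := by
    simp only [ascents, if_neg (not_lt.2 hd.2.le), zero_add]
  have hneg : ascents (-m :: l) = ascents l + 1 := by
    simp only [ascents, if_pos hd.1, add_comm]
  simp only [signedInsertions, List.map_cons, List.sum_cons, hpos, hneg,
    sum_tailInsertions f hm l h]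
  ring

theorem perm_of_mem_tailInsertions {m : ℤ} {l w : List ℤ} (h : w ∈ tailInsertions m l) :
    w.Perm (m :: l) ∨ w.Perm (-m :: l) := by
  induction l generalizing w with
  | nil => simp [tailInsertions] at h
  | cons a l ih =>
    simp only [tailInsertions, List.mem_cons, List.mem_map] at h
    rcases h with rfl | rfl | ⟨v, hv, rfl⟩
    · exact Or.inl (List.Perm.swap _ _ _)
    · exact Or.inr (List.Perm.swap _ _ _)
    · exact (ih hv).imp (fun p => (p.cons a).trans (List.Perm.swap _ _ _))
        (fun p => (p.cons a).trans (List.Perm.swap _ _ _))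

theorem perm_of_mem_signedInsertions {m : ℤ} {l w : List ℤ} (h : w ∈ signedInsertions m l) :
    w.Perm (m :: l) ∨ w.Perm (-m :: l) := by
  simp only [signedInsertions, List.mem_cons] at h
  rcases h with rfl | rfl | h
  · exact Or.inl (List.Perm.refl _)
  · exact Or.inr (List.Perm.refl _)
  · exact perm_of_mem_tailInsertions h

theorem append_cons_mem_signedInsertions {m x : ℤ} (hx : x = m ∨ x = -m) (s t : List ℤ) :
    s ++ x :: t ∈ signedInsertions m (s ++ t) := by
  induction s with
  | nil => rcases hx with rfl | rfl <;> simp [signedInsertions]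
  | cons a s ih =>
    simp only [signedInsertions, List.mem_cons] at ih
    simp only [signedInsertions, tailInsertions, List.cons_append, List.mem_cons, List.mem_map]
    rcases ih with h | h | h
    · rw [h]; simp
    · rw [h]; simp
    · exact Or.inr (Or.inr (Or.inr (Or.inr ⟨_, h, rfl⟩)))

theorem cons_notMem_tailInsertions {m x : ℤ} (hm : 0 < m) (hx : |x| = m) {l : List ℤ}
    (h : ∀ y ∈ l, |y| < m) (v : List ℤ) : x :: v ∉ tailInsertions m l := by
  intro hv
  have hlt := abs_headD_lt hm h
  rw [← headD_of_mem_tailInsertions hv 0, List.headD_cons, hx] at hlt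
  exact lt_irrefl _ hlt

theorem nodup_tailInsertions {m : ℤ} (hm : 0 < m) (l : List ℤ) (h : ∀ x ∈ l, |x| < m) :
    (tailInsertions m l).Nodup := by
  induction l with
  | nil => simp [tailInsertions]
  | cons a l ih =>
    have hl : ∀ x ∈ l, |x| < m := fun x hx => h x (List.mem_cons_of_mem _ hx)
    have h1 := cons_notMem_tailInsertions hm (abs_of_pos hm) hl l
    have h2 := cons_notMem_tailInsertions hm (by rw [abs_neg, abs_of_pos hm]) hl l (x := -m)
    simp only [tailInsertions, List.nodup_cons, List.mem_cons, List.mem_map, List.cons.injEq,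
      true_and, not_or, not_exists, not_and, and_true]
    refine ⟨⟨by omega, ?_⟩, ?_, (ih hl).map List.cons_injective⟩
    · rintro v hv rfl; exact h1 hv
    · rintro v hv rfl; exact h2 hv

theorem nodup_signedInsertions {m : ℤ} (hm : 0 < m) (l : List ℤ) (h : ∀ x ∈ l, |x| < m) :
    (signedInsertions m l).Nodup := by
  have h1 := cons_notMem_tailInsertions hm (abs_of_pos hm) h l
  have h2 := cons_notMem_tailInsertions hm (by rw [abs_neg, abs_of_pos hm]) h l (x := -m)
  simp only [signedInsertions, List.nodup_cons, List.mem_cons, List.cons.injEq, and_true, not_or]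
  exact ⟨⟨by omega, h1⟩, h2, nodup_tailInsertions hm l h⟩

theorem filter_of_mem_signedInsertions {m : ℤ} (hm : 0 < m) {l w : List ℤ}
    (h : ∀ x ∈ l, |x| < m) (hw : w ∈ signedInsertions m l) :
    w.filter (fun x => |x| < m) = l := by
  have hl : l.filter (fun x => |x| < m) = l := by
    rw [List.filter_eq_self]; simpa using h
  have hmm : ¬ |m| < m := by rw [abs_of_pos hm]; exact lt_irrefl _
  have htail : ∀ l w : List ℤ, w ∈ tailInsertions m l →
      w.filter (fun x => |x| < m) = l.filter (fun x => |x| < m) := by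
    intro l
    induction l with
    | nil => simp [tailInsertions]
    | cons a l ih =>
      intro w hw
      simp only [tailInsertions, List.mem_cons, List.mem_map] at hw
      rcases hw with rfl | rfl | ⟨v, hv, rfl⟩
      · simp [List.filter_cons, hmm]
      · simp [List.filter_cons, hmm]
      · simp [List.filter_cons, ih v hv]
  simp only [signedInsertions, List.mem_cons] at hw
  rcases hw with rfl | rfl | hw
  · simpa [List.filter_cons, hmm] using h
  · simpa [List.filter_cons, hmm] using h
  · rw [htail l w hw, hl]

theorem mem_signedWords {n : ℕ} {l : List ℤ} :
    l ∈ signedWords n ↔ (l.map Int.natAbs).Perm (List.range' 1 n) := by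
  induction n generalizing l with
  | zero => simp [signedWords]
  | succ n ih =>
    have hr : (List.range' 1 (n + 1)).Perm ((n + 1) :: List.range' 1 n) := by
      rw [List.range'_concat]
      simp [add_comm]
    simp only [signedWords, List.mem_flatMap, ih]
    constructor
    · rintro ⟨v, hv, hl⟩
      have hp : (l.map Int.natAbs).Perm ((n + 1) :: v.map Int.natAbs) := by
        have e : ((n : ℤ) + 1).natAbs = n + 1 := by omega
        have e' : (-((n : ℤ) + 1)).natAbs = n + 1 := by omega
        rcases perm_of_mem_signedInsertions hl with p | p
        · simpa only [List.map_cons, e] using p.map Int.natAbs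
        · simpa only [List.map_cons, e'] using p.map Int.natAbs
      exact (hp.trans (hv.cons _)).trans hr.symm
    · intro h
      have h' := h.trans hr
      have hmem : n + 1 ∈ l.map Int.natAbs := h'.mem_iff.2 (by simp)
      obtain ⟨x, hx, hxn⟩ := List.mem_map.1 hmem
      obtain ⟨s, t, rfl⟩ := List.append_of_mem hx
      refine ⟨s ++ t, ?_, append_cons_mem_signedInsertions (by omega) s t⟩
      have hp := (List.perm_middle (a := x) (l₁ := s) (l₂ := t)).map Int.natAbs
      rw [List.map_cons, hxn] at hp
      exact (hp.symm.trans h').cons_inv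

theorem length_of_mem_signedWords {n : ℕ} {l : List ℤ} (h : l ∈ signedWords n) :
    l.length = n := by
  simpa using (mem_signedWords.1 h).length_eq

theorem abs_bounds_of_mem_signedWords {n : ℕ} {l : List ℤ} (h : l ∈ signedWords n) :
    ∀ x ∈ l, 1 ≤ |x| ∧ |x| ≤ (n : ℤ) := by
  intro x hx
  have := (mem_signedWords.1 h).mem_iff.1 (List.mem_map_of_mem hx)
  rw [List.mem_range'_1] at this
  rw [Int.abs_eq_natAbs]
  omega

theorem abs_lt_of_mem_signedWords {n : ℕ} {l : List ℤ} (h : l ∈ signedWords n) :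
    ∀ x ∈ l, |x| < (n : ℤ) + 1 :=
  fun x hx => Int.lt_add_one_of_le (abs_bounds_of_mem_signedWords h x hx).2

theorem nodup_signedWords (n : ℕ) : (signedWords n).Nodup := by
  induction n with
  | zero => simp [signedWords]
  | succ n ih =>
    have hm : (0 : ℤ) < (n : ℤ) + 1 := by positivity
    rw [signedWords, List.nodup_flatMap]
    refine ⟨fun l hl => nodup_signedInsertions hm l (abs_lt_of_mem_signedWords hl), ?_⟩
    refine List.Pairwise.imp_of_mem (fun {u v} hu hv huv => ?_) ih
    intro w hwu hwv
    exact huv ((filter_of_mem_signedInsertions hm (abs_lt_of_mem_signedWords hu) hwu).symm.trans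
      (filter_of_mem_signedInsertions hm (abs_lt_of_mem_signedWords hv) hwv))

theorem sum_signedWords_succ (f : ℕ → ℤ) (n : ℕ) :
    ((signedWords (n + 1)).map (fun w => f (ascents w))).sum =
      ((signedWords n).map (fun l => (2 * ascents l + 1) * f (ascents l) +
        (2 * ((n : ℤ) - ascents l) + 1) * f (ascents l + 1))).sum := by
  have hm : (0 : ℤ) < (n : ℤ) + 1 := by positivity
  rw [signedWords, List.map_flatMap, List.flatMap, List.sum_flatten, List.map_map]
  congr 1
  refine List.map_congr_left fun l hl => ?_
  rw [Function.comp_apply, sum_signedInsertions f hm l (abs_lt_of_mem_signedWords hl), length_of_mem_signedWords hl]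

/-- The alternating sum for the Eulerian numbers of type `B`. -/
def eulerianSum (n k : ℕ) : ℤ :=
  ∑ r ∈ Finset.range (k + 1),
    (-1 : ℤ) ^ r * (Nat.choose (n + 1) r : ℤ) * (2 * (k : ℤ) - 2 * r + 1) ^ n

theorem eulerianSum_zero_right (n : ℕ) : eulerianSum n 0 = 1 := by
  simp [eulerianSum]

theorem eulerianSum_zero_succ (k : ℕ) : eulerianSum 0 (k + 1) = 0 := by
  have h : ∀ r, Nat.choose 1 (r + 2) = 0 := fun r => Nat.choose_eq_zero_of_lt (by omega)
  simp [eulerianSum, Finset.sum_range_succ', h]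

theorem eulerianSum_succ_succ (n k : ℕ) :
    eulerianSum (n + 1) (k + 1) =
      (2 * ((k : ℤ) + 1) + 1) * eulerianSum n (k + 1) +
        (2 * ((n : ℤ) - k) + 1) * eulerianSum n k := by
  unfold eulerianSum
  rw [Finset.sum_range_succ', Finset.sum_range_succ' _ (k + 1), mul_add, Finset.mul_sum,
    Finset.mul_sum, add_right_comm (Finset.sum _ _), ← Finset.sum_add_distrib]
  congr 1
  · refine Finset.sum_congr rfl fun r _ => ?_
    have h1 : (Nat.choose (n + 1 + 1) (r + 1) : ℤ) =
        Nat.choose (n + 1) r + Nat.choose (n + 1) (r + 1) := by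
      exact_mod_cast Nat.choose_succ_succ (n + 1) r
    have h2 : (Nat.choose (n + 1) (r + 1) : ℤ) * (r + 1) =
        Nat.choose (n + 1) r * ((n : ℤ) + 1 - r) := by
      rcases le_or_gt r (n + 1) with hr | hr
      · have := Nat.choose_succ_right_eq (n + 1) r
        zify [hr] at this
        exact this
      · simp [Nat.choose_eq_zero_of_lt hr, Nat.choose_eq_zero_of_lt (Nat.lt_succ_of_lt hr)]
    rw [h1]
    push_cast
    have e : (2 * ((k : ℤ) + 1) - 2 * (r + 1) + 1) = 2 * k - 2 * r + 1 := by ring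
    rw [e]
    linear_combination (2 * (-1) ^ r * (2 * (k : ℤ) - 2 * r + 1) ^ n) * h2
  · push_cast
    simp
    ring

theorem sum_signedWords_eq (n k : ℕ) :
    ((signedWords n).map (fun l => if ascents l = k then (1 : ℤ) else 0)).sum =
      eulerianSum n k := by
  induction n generalizing k with
  | zero =>
    cases k with
    | zero => simp [signedWords, ascents, eulerianSum_zero_right]
    | succ k => simp [signedWords, ascents, eulerianSum_zero_succ]
  | succ n ih =>
    rw [sum_signedWords_succ (fun j => if j = k then 1 else 0)]
    cases k with
    | zero =>
      refine Eq.trans ?_ (((ih 0).trans (eulerianSum_zero_right n)).trans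
        (eulerianSum_zero_right (n + 1)).symm)
      congr 1
      refine List.map_congr_left fun l _ => ?_
      by_cases h : ascents l = 0 <;> simp [h]
    | succ k =>
      rw [eulerianSum_succ_succ, ← ih, ← ih, ← List.sum_map_mul_left, ← List.sum_map_mul_left,
        ← List.sum_map_add]
      congr 1
      refine List.map_congr_left fun l _ => ?_
      by_cases h : ascents l = k + 1
      · simp [h]
      · by_cases h' : ascents l = k <;> simp [h, h']

theorem card_filter_signedWords (n k : ℕ) :
    (((signedWords n).toFinset.filter (fun l => ascents l = k)).card : ℤ) = eulerianSum n k := by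
  rw [← sum_signedWords_eq, Finset.card_filter, Nat.cast_sum,
    List.sum_toFinset _ (nodup_signedWords n)]
  simp

theorem ascents_eq_sum (l : List ℤ) :
    ascents l = ∑ i ∈ Finset.range l.length,
      if l.getD i 0 < l.getD (i + 1) 0 then 1 else 0 := by
  induction l with
  | nil => rfl
  | cons a l ih =>
    rw [List.length_cons, Finset.sum_range_succ', ascents, ih, add_comm]
    congr 1
    cases l <;> simp

/-- The sign-preserving involution of `{±1, …, ±n}` with `|x| ↦ n + 1 - |x|`. -/
def flipAbs (n : ℕ) (x : ℤ) : ℤ :=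
  if 0 < x then (n : ℤ) + 1 - x else -((n : ℤ) + 1) - x

theorem abs_flipAbs {n : ℕ} {x : ℤ} (h : 1 ≤ |x| ∧ |x| ≤ (n : ℤ)) :
    |flipAbs n x| = n + 1 - |x| := by
  unfold flipAbs
  split_ifs with h0
  · rw [abs_of_pos h0] at h ⊢
    exact abs_of_pos (by omega)
  · rw [abs_of_nonpos (not_lt.1 h0)] at h ⊢
    rw [abs_of_neg (by omega)]
    ring

theorem flipAbs_flipAbs {n : ℕ} {x : ℤ} (h : 1 ≤ |x| ∧ |x| ≤ (n : ℤ)) :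
    flipAbs n (flipAbs n x) = x := by
  simp only [le_abs, abs_le] at h
  unfold flipAbs
  split_ifs <;> omega

theorem signedRank_lt_signedRank_iff {n : ℕ} {x y : ℤ} (hx : 1 ≤ |x| ∧ |x| ≤ (n : ℤ))
    (hy : 1 ≤ |y| ∧ |y| ≤ (n : ℤ)) :
    signedRank n y < signedRank n x ↔ flipAbs n x < flipAbs n y := by
  simp only [le_abs, abs_le] at hx hy
  unfold signedRank flipAbs
  split_ifs <;> omega

theorem flipAbs_neg_iff {n : ℕ} {x : ℤ} (h : 1 ≤ |x| ∧ |x| ≤ (n : ℤ)) :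
    flipAbs n x < 0 ↔ x < 0 := by
  simp only [le_abs, abs_le] at h
  unfold flipAbs
  split_ifs <;> omega

theorem flipAbs_bounds {n : ℕ} {x : ℤ} (h : 1 ≤ |x| ∧ |x| ≤ (n : ℤ)) :
    1 ≤ |flipAbs n x| ∧ |flipAbs n x| ≤ (n : ℤ) := by
  rw [abs_flipAbs h]
  omega

/-- `σ` is a signed permutation of `{±1, …, ±n}`, extended by the identity. -/
def IsSignedPerm (n : ℕ) (σ : ℤ → ℤ) : Prop :=
  Set.BijOn σ {x : ℤ | 1 ≤ |x| ∧ |x| ≤ (n : ℤ)} {x : ℤ | 1 ≤ |x| ∧ |x| ≤ (n : ℤ)} ∧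
    (∀ x : ℤ, σ (-x) = -σ x) ∧ ∀ x : ℤ, ¬(1 ≤ |x| ∧ |x| ≤ (n : ℤ)) → σ x = x

/-- The word of `σ`, with all letters flipped by `flipAbs`. -/
def flippedWord (n : ℕ) (σ : ℤ → ℤ) : List ℤ :=
  (List.range n).map fun i : ℕ => flipAbs n (σ ((i : ℤ) + 1))

theorem succ_bounds {n i : ℕ} (hi : i < n) : 1 ≤ |(i : ℤ) + 1| ∧ |(i : ℤ) + 1| ≤ (n : ℤ) := by
  rw [abs_of_pos (by positivity)]
  omega

theorem IsSignedPerm.bounds {n : ℕ} {σ : ℤ → ℤ} (h : IsSignedPerm n σ) {i : ℕ} (hi : i < n) :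
    1 ≤ |σ ((i : ℤ) + 1)| ∧ |σ ((i : ℤ) + 1)| ≤ (n : ℤ) :=
  h.1.mapsTo (succ_bounds hi)

theorem getD_flippedWord {n : ℕ} (σ : ℤ → ℤ) {i : ℕ} (hi : i < n) :
    (flippedWord n σ).getD i 0 = flipAbs n (σ ((i : ℤ) + 1)) := by
  simp [flippedWord, List.getD_eq_getElem?_getD, hi]

theorem length_flippedWord (n : ℕ) (σ : ℤ → ℤ) : (flippedWord n σ).length = n := by
  simp [flippedWord]

theorem IsSignedPerm.flippedWord_mem {n : ℕ} {σ : ℤ → ℤ} (h : IsSignedPerm n σ) :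
    flippedWord n σ ∈ signedWords n := by
  rw [mem_signedWords]
  refine List.Subperm.perm_of_length_le (List.Nodup.subperm ?_ ?_) (by simp [flippedWord])
  · rw [flippedWord, List.map_map]
    refine List.Nodup.map_on ?_ List.nodup_range
    intro i hi j hj hij
    rw [List.mem_range] at hi hj
    have e : |flipAbs n (σ ((i : ℤ) + 1))| = |flipAbs n (σ ((j : ℤ) + 1))| := by
      rw [Int.abs_eq_natAbs, Int.abs_eq_natAbs]
      exact congrArg Nat.cast hij
    rw [abs_flipAbs (h.bounds hi), abs_flipAbs (h.bounds hj)] at e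
    rcases abs_eq_abs.1 (sub_right_injective e) with e | e
    · have := h.1.injOn (succ_bounds hi) (succ_bounds hj) e
      omega
    · rw [← h.2.1] at e
      have hj' : -((j : ℤ) + 1) ∈ {x : ℤ | 1 ≤ |x| ∧ |x| ≤ (n : ℤ)} := by
        rw [Set.mem_ofPred_eq, abs_neg]
        exact succ_bounds hj
      have := h.1.injOn (succ_bounds hi) hj' e
      omega
  · intro a ha
    simp only [flippedWord, List.map_map, List.mem_map, List.mem_range, Function.comp] at ha
    obtain ⟨i, hi, rfl⟩ := ha
    have := flipAbs_bounds (h.bounds hi)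
    rw [Int.abs_eq_natAbs] at this
    rw [List.mem_range'_1]
    omega

theorem IsSignedPerm.card_descents {n : ℕ} {σ : ℤ → ℤ} (h : IsSignedPerm n σ) :
    (Finset.filter
      (fun i : ℤ =>
        (i < (n : ℤ) ∧ signedRank n (σ (i + 1)) < signedRank n (σ i)) ∨
        (i = (n : ℤ) ∧ σ i < 0))
      (Finset.Icc (1 : ℤ) (n : ℤ))).card = ascents (flippedWord n σ) := by
  rw [ascents_eq_sum, length_flippedWord, Finset.card_filter]
  symm
  refine Finset.sum_bij (fun i _ => (i : ℤ) + 1) ?_ ?_ ?_ ?_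
  · intro i hi
    rw [Finset.mem_range] at hi
    rw [Finset.mem_Icc]
    omega
  · intro i _ j _ hij
    omega
  · intro x hx
    rw [Finset.mem_Icc] at hx
    exact ⟨(x - 1).toNat, Finset.mem_range.2 (by omega), by omega⟩
  · intro i hi
    rw [Finset.mem_range] at hi
    refine if_congr ?_ rfl rfl
    rw [getD_flippedWord σ hi]
    rcases Nat.lt_or_ge (i + 1) n with hi' | hi'
    · rw [getD_flippedWord σ hi', Nat.cast_succ, ← signedRank_lt_signedRank_iff (h.bounds hi)
        (by simpa using h.bounds hi')]
      have h1 : (i : ℤ) + 1 < n := by omega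
      simp [h1, h1.ne]
    · rw [List.getD_eq_default _ _ (by rwa [length_flippedWord]), flipAbs_neg_iff (h.bounds hi)]
      have h1 : (i : ℤ) + 1 = n := by omega
      simp [h1]

theorem exists_eq_succ_or_neg {n : ℕ} {x : ℤ} (h : 1 ≤ |x| ∧ |x| ≤ (n : ℤ)) :
    ∃ i : ℕ, i < n ∧ (x = (i : ℤ) + 1 ∨ x = -((i : ℤ) + 1)) := by
  rw [Int.abs_eq_natAbs] at h
  exact ⟨x.natAbs - 1, by omega, by omega⟩

theorem IsSignedPerm.flippedWord_injective {n : ℕ} {σ τ : ℤ → ℤ} (hσ : IsSignedPerm n σ)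
    (hτ : IsSignedPerm n τ) (h : flippedWord n σ = flippedWord n τ) : σ = τ := by
  have key : ∀ i : ℕ, i < n → σ ((i : ℤ) + 1) = τ ((i : ℤ) + 1) := by
    intro i hi
    rw [← flipAbs_flipAbs (hσ.bounds hi), ← flipAbs_flipAbs (hτ.bounds hi),
      ← getD_flippedWord σ hi, ← getD_flippedWord τ hi, h]
  funext x
  by_cases hx : 1 ≤ |x| ∧ |x| ≤ (n : ℤ)
  · obtain ⟨i, hi, rfl | rfl⟩ := exists_eq_succ_or_neg hx
    · exact key i hi
    · rw [hσ.2.1, hτ.2.1, key i hi]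
  · rw [hσ.2.2 x hx, hτ.2.2 x hx]

/-- The signed permutation with flipped word `l`. -/
def ofFlippedWord (n : ℕ) (l : List ℤ) (x : ℤ) : ℤ :=
  if 1 ≤ |x| ∧ |x| ≤ (n : ℤ) then x.sign * flipAbs n (l.getD (x.natAbs - 1) 0) else x

theorem ofFlippedWord_neg (n : ℕ) (l : List ℤ) (x : ℤ) :
    ofFlippedWord n l (-x) = -ofFlippedWord n l x := by
  unfold ofFlippedWord
  rw [abs_neg, Int.sign_neg, Int.natAbs_neg]
  split_ifs
  · ring
  · rfl

theorem ofFlippedWord_succ {n i : ℕ} (l : List ℤ) (hi : i < n) :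
    ofFlippedWord n l ((i : ℤ) + 1) = flipAbs n (l.getD i 0) := by
  rw [ofFlippedWord, if_pos (succ_bounds hi), Int.sign_eq_one_of_pos (by positivity), one_mul]
  congr 2

theorem getD_bounds {n : ℕ} {l : List ℤ} (hl : l ∈ signedWords n) {i : ℕ} (hi : i < n) :
    1 ≤ |l.getD i 0| ∧ |l.getD i 0| ≤ (n : ℤ) := by
  have hi' : i < l.length := by rwa [length_of_mem_signedWords hl]
  rw [List.getD_eq_getElem _ _ hi']
  exact abs_bounds_of_mem_signedWords hl _ (List.getElem_mem hi')

theorem abs_getD_injective {n : ℕ} {l : List ℤ} (hl : l ∈ signedWords n) {i j : ℕ} (hi : i < n)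
    (hj : j < n) (h : |l.getD i 0| = |l.getD j 0|) : i = j := by
  have hlen := length_of_mem_signedWords hl
  have hi' : i < l.length := by rwa [hlen]
  have hj' : j < l.length := by rwa [hlen]
  have hnd : (l.map Int.natAbs).Nodup := (mem_signedWords.1 hl).nodup_iff.2 List.nodup_range'
  rw [List.getD_eq_getElem _ _ hi', List.getD_eq_getElem _ _ hj'] at h
  refine (hnd.getElem_inj_iff (hi := by simpa using hi') (hj := by simpa using hj')).1 ?_
  rw [List.getElem_map, List.getElem_map]
  exact Int.natAbs_eq_natAbs_iff.2 (abs_eq_abs.1 h)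

theorem isSignedPerm_ofFlippedWord {n : ℕ} {l : List ℤ} (hl : l ∈ signedWords n) :
    IsSignedPerm n (ofFlippedWord n l) := by
  have hmaps : Set.MapsTo (ofFlippedWord n l) {x : ℤ | 1 ≤ |x| ∧ |x| ≤ (n : ℤ)}
      {x : ℤ | 1 ≤ |x| ∧ |x| ≤ (n : ℤ)} := by
    intro x hx
    obtain ⟨i, hi, rfl | rfl⟩ := exists_eq_succ_or_neg hx
    · rw [ofFlippedWord_succ l hi]
      exact flipAbs_bounds (getD_bounds hl hi)
    · rw [ofFlippedWord_neg, ofFlippedWord_succ l hi, Set.mem_ofPred_eq, abs_neg]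
      exact flipAbs_bounds (getD_bounds hl hi)
  have habs : ∀ i j : ℕ, i < n → j < n →
      |ofFlippedWord n l ((i : ℤ) + 1)| = |ofFlippedWord n l ((j : ℤ) + 1)| → i = j := by
    intro i j hi hj hij
    rw [ofFlippedWord_succ l hi, ofFlippedWord_succ l hj, abs_flipAbs (getD_bounds hl hi),
      abs_flipAbs (getD_bounds hl hj)] at hij
    exact abs_getD_injective hl hi hj (sub_right_injective hij)
  have hinj : Set.InjOn (ofFlippedWord n l) {x : ℤ | 1 ≤ |x| ∧ |x| ≤ (n : ℤ)} := by
    intro x hx y hy hxy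
    have hx' := (hmaps hx).1
    obtain ⟨i, hi, hxi⟩ := exists_eq_succ_or_neg hx
    obtain ⟨j, hj, hyj⟩ := exists_eq_succ_or_neg hy
    have hij : i = j := by
      refine habs i j hi hj ?_
      have := congrArg abs hxy
      rcases hxi with rfl | rfl <;> rcases hyj with rfl | rfl <;>
        simpa only [ofFlippedWord_neg, abs_neg] using this
    subst hij
    have hne : ofFlippedWord n l ((i : ℤ) + 1) ≠ 0 := by
      rw [← abs_pos]
      exact lt_of_lt_of_le zero_lt_one (hmaps (succ_bounds hi)).1
    rcases hxi with rfl | rfl <;> rcases hyj with rfl | rfl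
    · rfl
    · rw [ofFlippedWord_neg] at hxy
      omega
    · rw [ofFlippedWord_neg] at hxy
      omega
    · rfl
  have hfin : {x : ℤ | 1 ≤ |x| ∧ |x| ≤ (n : ℤ)}.Finite :=
    (Set.finite_Icc (-(n : ℤ)) n).subset fun x hx => abs_le.1 hx.2
  exact ⟨(hfin.injOn_iff_bijOn_of_mapsTo hmaps).1 hinj, ofFlippedWord_neg n l,
    fun x hx => if_neg hx⟩

theorem flippedWord_ofFlippedWord {n : ℕ} {l : List ℤ} (hl : l ∈ signedWords n) :
    flippedWord n (ofFlippedWord n l) = l := by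
  have hlen := length_of_mem_signedWords hl
  refine List.ext_getElem (by rw [length_flippedWord, hlen]) fun i h1 h2 => ?_
  have hi : i < n := by rwa [hlen] at h2
  rw [← List.getD_eq_getElem _ 0 h1, ← List.getD_eq_getElem _ 0 h2, getD_flippedWord _ hi,
    ofFlippedWord_succ l hi, flipAbs_flipAbs (getD_bounds hl hi)]

theorem stmt11 (n : ℕ) (hn : 1 ≤ n) (k : ℕ) (hk : k ≤ n) :
    (Nat.card {σ : ℤ → ℤ //
        Set.BijOn σ {x : ℤ | 1 ≤ |x| ∧ |x| ≤ (n : ℤ)} {x : ℤ | 1 ≤ |x| ∧ |x| ≤ (n : ℤ)} ∧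
        (∀ x : ℤ, σ (-x) = -σ x) ∧
        (∀ x : ℤ, ¬(1 ≤ |x| ∧ |x| ≤ (n : ℤ)) → σ x = x) ∧
        (Finset.filter
          (fun i : ℤ =>
            (i < (n : ℤ) ∧ signedRank n (σ (i + 1)) < signedRank n (σ i)) ∨
            (i = (n : ℤ) ∧ σ i < 0))
          (Finset.Icc (1 : ℤ) (n : ℤ))).card = k} : ℤ)
      = ∑ r ∈ Finset.range (k + 1),
          (-1 : ℤ) ^ r * (Nat.choose (n + 1) r : ℤ) * (2 * (k : ℤ) - 2 * r + 1) ^ n := by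
  refine Eq.trans ?_ (card_filter_signedWords n k)
  rw [← Set.ncard_coe_finset]
  congr 1
  refine Set.ncard_congr (fun σ _ => flippedWord n σ) ?_ ?_ ?_
  · rintro σ ⟨h1, h2, h3, h4⟩
    have h : IsSignedPerm n σ := ⟨h1, h2, h3⟩
    rw [Finset.mem_coe, Finset.mem_filter, List.mem_toFinset]
    exact ⟨h.flippedWord_mem, h.card_descents.symm.trans h4⟩
  · rintro σ τ ⟨h1, h2, h3, -⟩ ⟨h1', h2', h3', -⟩ h
    exact IsSignedPerm.flippedWord_injective ⟨h1, h2, h3⟩ ⟨h1', h2', h3'⟩ h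
  · intro l hl
    rw [Finset.mem_coe, Finset.mem_filter, List.mem_toFinset] at hl
    have h := isSignedPerm_ofFlippedWord hl.1
    have hw := flippedWord_ofFlippedWord hl.1
    exact ⟨ofFlippedWord n l, ⟨h.1, h.2.1, h.2.2, by rw [h.card_descents, hw, hl.2]⟩, hw⟩
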